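/- arXiv:math/0503155 — 2 statements merged into one kernel-verified Lean document; each statement's English description precedes it below -/
import Mathlib

section
/- Every simple antisymmetric cone admits an order-embedding into a simple normally divisible refinement cone satisfying the axiom (WSD). -/
universe u

/-- Conical commutative monoid ("cone"): `x + y = 0` implies `x = y = 0`. -/
def IsConical (M : Type u) [AddCommMonoid M] : Prop :=
  ∀ x y : M, x + y = 0 → x = 0 ∧ y = 0

/-- Algebraic preorder: `x ≤ y` iff `∃ z, x + z = y`. -/
def AlgLE {M : Type u} [AddCommMonoid M] (x y : M) : Prop :=
  ∃ z : M, x + z = y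

/-- Refinement monoid. -/
def IsRefinementMonoid (M : Type u) [AddCommMonoid M] : Prop :=
  ∀ a₀ a₁ b₀ b₁ : M, a₀ + a₁ = b₀ + b₁ →
    ∃ c₀₀ c₀₁ c₁₀ c₁₁ : M,
      a₀ = c₀₀ + c₀₁ ∧ a₁ = c₁₀ + c₁₁ ∧ b₀ = c₀₀ + c₁₀ ∧ b₁ = c₀₁ + c₁₁

/-- Unitary homomorphism: injective, cofinal image, and `f a₀ + b = f a₁ → b ∈ range f`. -/
def IsUnitary {A : Type u} {B : Type u} [AddCommMonoid A] [AddCommMonoid B]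
    (f : A →+ B) : Prop :=
  Function.Injective f ∧
  (∀ b : B, ∃ a : A, AlgLE b (f a)) ∧
  (∀ a₀ a₁ : A, ∀ b : B, f a₀ + b = f a₁ → b ∈ Set.range f)

/-- Strongly unitary homomorphism. -/
def IsStronglyUnitary {A : Type u} {B : Type u} [AddCommMonoid A] [AddCommMonoid B]
    (f : A →+ B) : Prop :=
  IsUnitary f ∧ ∀ m : ℕ, 0 < m → ∀ b : B, m • b ∈ Set.range f → b ∈ Set.range f

/-- Normally divisible commutative monoid. -/
def IsNormallyDivisible (M : Type u) [AddCommMonoid M] : Prop :=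
  ∀ p : ℕ, 0 < p → ∀ X : Finset M, ∀ a : M,
    ∃ u : M, p • u = a ∧ ∀ x ∈ X, ∀ y ∈ X, x + a = y + a → x + u = y + u

/-- Order-embedding of commutative monoids (w.r.t. the algebraic preorders). -/
def IsOrderEmbeddingHom {A : Type u} {B : Type u} [AddCommMonoid A] [AddCommMonoid B]
    (f : A →+ B) : Prop :=
  Function.Injective f ∧ ∀ x y : A, AlgLE x y ↔ AlgLE (f x) (f y)

/-- Simple commutative monoid: every `u ≰ 0` is an order-unit. -/
def IsSimpleMonoid (M : Type u) [AddCommMonoid M] : Prop :=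
  ∀ u : M, ¬ AlgLE u 0 → ∀ x : M, ∃ n : ℕ, 0 < n ∧ AlgLE x (n • u)

/-- Weak sum decomposition axiom (WSD). -/
def WSD (M : Type u) [AddCommMonoid M] : Prop :=
  ∀ a₀ a₁ b c : M, a₀ + a₁ + c = b + c →
    ∃ x₀ x₁ : M, a₀ + c = x₀ + c ∧ a₁ + c = x₁ + c ∧ b = x₀ + x₁

/-- `a ∝ b` : `a ≤ n • b` for some positive integer `n`. -/
def Propto {M : Type u} [AddCommMonoid M] (a b : M) : Prop :=
  ∃ n : ℕ, 0 < n ∧ AlgLE a (n • b)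

/-- `a ≍ b` : `a ∝ b` and `b ∝ a`. -/
def Asymp {M : Type u} [AddCommMonoid M] (a b : M) : Prop :=
  Propto a b ∧ Propto b a

/-- Cancellative commutative monoid. -/
def IsCancellativeMonoid (M : Type u) [AddCommMonoid M] : Prop :=
  ∀ x y z : M, x + z = y + z → x = y

/-- Separative commutative monoid. -/
def IsSeparative (M : Type u) [AddCommMonoid M] : Prop :=
  ∀ x y : M, 2 • x = x + y → x + y = 2 • y → x = y

/-- Stably finite commutative monoid. -/
def IsStablyFinite (M : Type u) [AddCommMonoid M] : Prop :=
  ∀ x y : M, x + y = y → x = 0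

/-- Quasi-divisible commutative monoid. -/
def IsQuasiDivisible (M : Type u) [AddCommMonoid M] : Prop :=
  ∀ x : M, ∃ u v : M, 2 • u + 3 • v = x

/-- `ℙ`-torsion-free commutative monoid. -/
def PTorsionFree (P : Set ℕ) (M : Type u) [AddCommMonoid M] : Prop :=
  ∀ p ∈ P, ∀ x y : M, p • x = p • y → x = y

/-- `ℙ`-unperforated commutative monoid (w.r.t. the algebraic preorder). -/
def PUnperforated (P : Set ℕ) (M : Type u) [AddCommMonoid M] : Prop :=
  ∀ p ∈ P, ∀ x y : M, AlgLE (p • x) (p • y) → AlgLE x y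

section Basic

variable {M : Type u} [AddCommMonoid M]

theorem algLE_refl (x : M) : AlgLE x x := ⟨0, add_zero x⟩

theorem AlgLE.trans {x y z : M} : AlgLE x y → AlgLE y z → AlgLE x z := by
  rintro ⟨a, rfl⟩ ⟨b, rfl⟩
  exact ⟨a + b, by abel⟩

theorem AlgLE.add {x y x' y' : M} : AlgLE x y → AlgLE x' y' → AlgLE (x + x') (y + y') := by
  rintro ⟨a, rfl⟩ ⟨b, rfl⟩
  exact ⟨a + b, by abel⟩

theorem AlgLE.nsmul {x y : M} (n : ℕ) : AlgLE x y → AlgLE (n • x) (n • y) := by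
  rintro ⟨a, rfl⟩
  exact ⟨n • a, (nsmul_add x a n).symm⟩

theorem algLE_add_right (x y : M) : AlgLE x (x + y) := ⟨y, rfl⟩

theorem algLE_add_left (x y : M) : AlgLE x (y + x) := ⟨y, add_comm x y⟩

theorem AlgLE.map {N : Type u} [AddCommMonoid N] (f : M →+ N) {x y : M} :
    AlgLE x y → AlgLE (f x) (f y) := by
  rintro ⟨a, rfl⟩
  exact ⟨f a, (map_add f x a).symm⟩

theorem Propto.trans {x y z : M} : Propto x y → Propto y z → Propto x z := by
  rintro ⟨m, hm, hxy⟩ ⟨n, hn, hyz⟩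
  refine ⟨m * n, Nat.mul_pos hm hn, hxy.trans ?_⟩
  rw [mul_nsmul']
  exact hyz.nsmul m

theorem AlgLE.propto {x y : M} (h : AlgLE x y) : Propto x y :=
  ⟨1, one_pos, by rwa [one_nsmul]⟩

theorem Propto.map {N : Type u} [AddCommMonoid N] (f : M →+ N) {x y : M} :
    Propto x y → Propto (f x) (f y) := by
  rintro ⟨n, hn, h⟩
  exact ⟨n, hn, by simpa using h.map f⟩

variable (M) in
/-- The algebraic preorder is antisymmetric. -/
def IsAntisymmetric : Prop := ∀ x y : M, AlgLE x y → AlgLE y x → x = y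

theorem IsAntisymmetric.isConical (h : IsAntisymmetric M) : IsConical M := fun x y hxy =>
  ⟨h x 0 ⟨y, hxy⟩ ⟨x, zero_add x⟩, h y 0 ⟨x, by rwa [add_comm]⟩ ⟨y, zero_add y⟩⟩

/-- A homomorphism reflecting the algebraic preorder. -/
def Reflects {N : Type u} [AddCommMonoid N] (f : M →+ N) : Prop :=
  ∀ x y, AlgLE (f x) (f y) → AlgLE x y

theorem Reflects.injective {N : Type u} [AddCommMonoid N] {f : M →+ N} (hf : Reflects f)
    (hM : IsAntisymmetric M) : Function.Injective f := fun x y h =>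
  hM x y (hf x y (h ▸ algLE_refl _)) (hf y x (h ▸ algLE_refl _))

theorem Reflects.comp {N P : Type u} [AddCommMonoid N] [AddCommMonoid P] {g : N →+ P} {f : M →+ N}
    (hg : Reflects g) (hf : Reflects f) : Reflects (g.comp f) := fun x y h =>
  hf x y (hg _ _ h)

end Basic

/-- A cone-theoretic problem with parameters in `M`: a refinement, a division, or a weak sum
decomposition. -/
inductive Problem (M : Type u) : Type u
  | refine (a₀ a₁ b₀ b₁ : M)
  | divide (p : ℕ) (a : M)
  | decompose (a₀ a₁ b c : M)

/-- The image of a problem under a map. -/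
def Problem.map {M N : Type u} (f : M → N) : Problem M → Problem N
  | refine a₀ a₁ b₀ b₁ => refine (f a₀) (f a₁) (f b₀) (f b₁)
  | divide p a => divide p (f a)
  | decompose a₀ a₁ b c => decompose (f a₀) (f a₁) (f b) (f c)

/-- The image under `f` of the given problem has a solution in the codomain of `f`. -/
def Solves {M N : Type u} [AddCommMonoid M] [AddCommMonoid N] (f : M →+ N) : Problem M → Prop
  | .refine a₀ a₁ b₀ b₁ => a₀ + a₁ = b₀ + b₁ → ∃ c₀₀ c₀₁ c₁₀ c₁₁ : N,
      f a₀ = c₀₀ + c₀₁ ∧ f a₁ = c₁₀ + c₁₁ ∧ f b₀ = c₀₀ + c₁₀ ∧ f b₁ = c₀₁ + c₁₁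
  | .divide p a => 0 < p → ∃ u : N, p • u = f a ∧ ∀ x y : M, x + a = y + a → f x + u = f y + u
  | .decompose a₀ a₁ b c => a₀ + a₁ + c = b + c → ∃ x₀ x₁ : N,
      f a₀ + f c = x₀ + f c ∧ f a₁ + f c = x₁ + f c ∧ f b = x₀ + x₁

section Solves

variable {M N P : Type u} [AddCommMonoid M] [AddCommMonoid N] [AddCommMonoid P]

theorem Solves.comp_left {f : M →+ N} (g : N →+ P) {q : Problem M} (h : Solves f q) :
    Solves (g.comp f) q := by
  cases q with
  | refine a₀ a₁ b₀ b₁ =>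
    intro e
    obtain ⟨c₀₀, c₀₁, c₁₀, c₁₁, h₁, h₂, h₃, h₄⟩ := h e
    exact ⟨g c₀₀, g c₀₁, g c₁₀, g c₁₁, by simp [h₁], by simp [h₂], by simp [h₃], by simp [h₄]⟩
  | divide p a =>
    intro hp
    obtain ⟨u, hu, h⟩ := h hp
    refine ⟨g u, by simp [← hu], fun x y hxy => ?_⟩
    simpa using congrArg g (h x y hxy)
  | decompose a₀ a₁ b c =>
    intro e
    obtain ⟨x₀, x₁, h₁, h₂, h₃⟩ := h e
    exact ⟨g x₀, g x₁, by simpa using congrArg g h₁, by simpa using congrArg g h₂, by simp [h₃]⟩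

theorem Solves.comp_right (f : M →+ N) {g : N →+ P} {q : Problem M} (h : Solves g (q.map f)) :
    Solves (g.comp f) q := by
  cases q with
  | refine a₀ a₁ b₀ b₁ => exact fun e => h (by simpa using congrArg f e)
  | divide p a =>
    intro hp
    obtain ⟨u, hu, h⟩ := h hp
    exact ⟨u, hu, fun x y hxy => h (f x) (f y) (by simpa using congrArg f hxy)⟩
  | decompose a₀ a₁ b c => exact fun e => h (by simpa using congrArg f e)

end Solves

section Antisymmetrization

variable (E : Type u) [AddCommMonoid E]

/-- The congruence identifying elements equivalent for the algebraic preorder. -/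
def antisymmCon : AddCon E where
  r x y := AlgLE x y ∧ AlgLE y x
  iseqv := ⟨fun x => ⟨algLE_refl x, algLE_refl x⟩, fun h => ⟨h.2, h.1⟩,
    fun h k => ⟨h.1.trans k.1, k.2.trans h.2⟩⟩
  add' h k := ⟨h.1.add k.1, h.2.add k.2⟩

variable {E}

theorem algLE_of_antisymmCon_mk {x y : E}
    (h : AlgLE ((antisymmCon E).mk' x) ((antisymmCon E).mk' y)) : AlgLE x y := by
  obtain ⟨z, hz⟩ := h
  obtain ⟨z, rfl⟩ := AddCon.mk'_surjective z
  rw [← map_add] at hz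
  exact (algLE_add_right x z).trans ((antisymmCon E).eq.1 hz).1

theorem isAntisymmetric_antisymmCon : IsAntisymmetric (antisymmCon E).Quotient := by
  intro x y hxy hyx
  obtain ⟨x, rfl⟩ := AddCon.mk'_surjective x
  obtain ⟨y, rfl⟩ := AddCon.mk'_surjective y
  exact (antisymmCon E).eq.2 ⟨algLE_of_antisymmCon_mk hxy, algLE_of_antisymmCon_mk hyx⟩

theorem reflects_antisymmCon : Reflects (antisymmCon E).mk' :=
  fun _ _ => algLE_of_antisymmCon_mk

end Antisymmetrization

section Syntactic

variable {F M : Type u} [AddCommMonoid F]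

/-- The syntactic congruence of a set-valued map `W`: the coarsest congruence along which `W` is
constant. -/
def syntacticCon (W : F → Set M) : AddCon F where
  r f g := ∀ h, W (f + h) = W (g + h)
  iseqv := ⟨fun _ _ => rfl, fun h k => (h k).symm, fun h k l => (h l).trans (k l)⟩
  add' {a b c d} h k l := by
    have h₁ := h (c + l)
    have h₂ := k (b + l)
    rw [show a + c + l = a + (c + l) by abel, h₁, show b + (c + l) = c + (b + l) by abel, h₂]
    congr 1
    abel

theorem syntacticCon_mk_eq {W : F → Set M} {f g : F} (h : ∀ k, W (f + k) = W (g + k)) :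
    (syntacticCon W).mk' f = (syntacticCon W).mk' g :=
  (syntacticCon W).eq.2 h

theorem reflects_syntacticCon [AddCommMonoid M] {W : F → Set M} {i : M →+ F} (hi : ∀ y, y ∈ W (i y))
    (hW : ∀ x z y, y ∈ W (i x + z) → AlgLE x y) : Reflects ((syntacticCon W).mk'.comp i) := by
  rintro x y ⟨z, hz⟩
  obtain ⟨z, rfl⟩ := AddCon.mk'_surjective z
  have h := (syntacticCon W).eq.1 hz 0
  rw [add_zero] at h
  refine hW x z y ?_
  have := hi y
  simp only [add_zero] at h
  rw [h]
  exact this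

end Syntactic

section OneStep

variable {M : Type u} [AddCommMonoid M]

/-- The values in `M` to which a formal sum with division terms reduces. -/
def divideValues (p : ℕ) (a : M) (f : M × ℕ) : Set M :=
  {y | ∃ q, f.2 = p * q ∧ y = f.1 + q • a}

theorem exists_solves_divide (p : ℕ) (a : M) :
    ∃ (E : Type u) (_ : AddCommMonoid E) (f : M →+ E), Reflects f ∧ Solves f (.divide p a) := by
  refine ⟨_, inferInstance, (syntacticCon (divideValues p a)).mk'.comp (AddMonoidHom.inl M ℕ),
    reflects_syntacticCon ?_ ?_, ?_⟩
  · intro y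
    exact ⟨0, by simp, by simp⟩
  · rintro x ⟨m, k⟩ y ⟨q, -, rfl⟩
    exact ⟨m + q • a, by simp [add_assoc]⟩
  intro hp
  refine ⟨(syntacticCon (divideValues p a)).mk' (0, 1), ?_, fun x y hxy => ?_⟩
  · rw [← map_nsmul]
    refine syntacticCon_mk_eq ?_
    rintro ⟨m, k⟩
    ext y
    constructor
    · rintro ⟨q, hq, rfl⟩
      simp only [Prod.fst_add, Prod.snd_add, Prod.smul_mk, smul_eq_mul, mul_one, smul_zero] at hq ⊢
      obtain ⟨r, rfl⟩ : ∃ r, q = r + 1 := Nat.exists_eq_succ_of_ne_zero (by rintro rfl; omega)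
      refine ⟨r, ?_, ?_⟩
      · simp
        linarith
      · simp [add_nsmul]; abel
    · rintro ⟨q, hq, rfl⟩
      refine ⟨q + 1, ?_, ?_⟩
      · simp at hq ⊢
        linarith
      · simp [add_nsmul]; abel
  · rw [AddMonoidHom.comp_apply, AddMonoidHom.comp_apply, ← map_add, ← map_add]
    refine syntacticCon_mk_eq ?_
    rintro ⟨m, k⟩
    ext z
    have key : ∀ x y, x + a = y + a → z ∈ divideValues p a ((x, 0) + (0, 1) + (m, k)) →
        z ∈ divideValues p a ((y, 0) + (0, 1) + (m, k)) := by
      rintro x y hxy ⟨q, hq, rfl⟩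
      refine ⟨q, hq, ?_⟩
      obtain ⟨r, rfl⟩ : ∃ r, q = r + 1 :=
        Nat.exists_eq_succ_of_ne_zero (by rintro rfl; simp at hq)
      simp only [Prod.fst_add, add_zero, add_nsmul, one_nsmul]
      calc x + m + (r • a + a) = (x + a) + (m + r • a) := by abel
        _ = (y + a) + (m + r • a) := by rw [hxy]
        _ = _ := by abel
    exact ⟨key x y hxy, key y x hxy.symm⟩

/-- The values in `M` to which a formal sum with decomposition terms reduces. -/
def decomposeValues (a₀ a₁ b c : M) (f : M × ℕ × ℕ) : Set M :=
  {y | ∃ j k l, f.2.1 = j + k ∧ f.2.2 = j + l ∧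
    (AlgLE c (f.1 + j • b) ∨ k = 0 ∧ l = 0) ∧ y = f.1 + j • b + k • a₀ + l • a₁}

theorem exists_solves_decompose (a₀ a₁ b c : M) :
    ∃ (E : Type u) (_ : AddCommMonoid E) (f : M →+ E),
      Reflects f ∧ Solves f (.decompose a₀ a₁ b c) := by
  refine ⟨_, inferInstance,
    (syntacticCon (decomposeValues a₀ a₁ b c)).mk'.comp (AddMonoidHom.inl M (ℕ × ℕ)),
    reflects_syntacticCon ?_ ?_, ?_⟩
  · intro y
    exact ⟨0, 0, 0, by simp⟩
  · rintro x ⟨m, k', l'⟩ y ⟨j, k, l, -, -, -, rfl⟩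
    exact ⟨m + j • b + k • a₀ + l • a₁, by simp [add_assoc]⟩
  intro e
  refine ⟨(syntacticCon (decomposeValues a₀ a₁ b c)).mk' (0, 1, 0),
    (syntacticCon (decomposeValues a₀ a₁ b c)).mk' (0, 0, 1), ?_, ?_, ?_⟩
  · rw [AddMonoidHom.comp_apply, AddMonoidHom.comp_apply, ← map_add, ← map_add]
    refine syntacticCon_mk_eq ?_
    rintro ⟨m, s, t⟩
    ext y
    constructor
    · rintro ⟨j, k, l, hs, ht, -, rfl⟩
      simp at hs ht
      refine ⟨j, k + 1, l, by simp; omega, by simp; omega, Or.inl ?_, ?_⟩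
      · exact ⟨m + j • b, by simp; abel⟩
      · simp [add_nsmul]; abel
    · rintro ⟨j, k, l, hs, ht, -, rfl⟩
      simp at hs ht
      have hc : ∀ i : ℕ, AlgLE c (a₀ + c + m + i • b) := fun i => ⟨a₀ + m + i • b, by abel⟩
      rcases k with _ | k
      · obtain ⟨i, rfl⟩ : ∃ i, j = i + 1 := ⟨s, by omega⟩
        refine ⟨i, 0, l + 1, by simp; omega, by simp; omega, Or.inl (by simpa using hc i), ?_⟩
        simp [add_nsmul]
        calc c + m + (i • b + b) + l • a₁ = (b + c) + (m + i • b + l • a₁) := by abel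
          _ = (a₀ + a₁ + c) + (m + i • b + l • a₁) := by rw [e]
          _ = _ := by abel
      · refine ⟨j, k, l, by simp; omega, by simp; omega, Or.inl (by simpa using hc j), ?_⟩
        simp [add_nsmul]; abel
  · rw [AddMonoidHom.comp_apply, AddMonoidHom.comp_apply, ← map_add, ← map_add]
    refine syntacticCon_mk_eq ?_
    rintro ⟨m, s, t⟩
    ext y
    constructor
    · rintro ⟨j, k, l, hs, ht, -, rfl⟩
      simp at hs ht
      refine ⟨j, k, l + 1, by simp; omega, by simp; omega, Or.inl ?_, ?_⟩
      · exact ⟨m + j • b, by simp; abel⟩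
      · simp [add_nsmul]; abel
    · rintro ⟨j, k, l, hs, ht, -, rfl⟩
      simp at hs ht
      have hc : ∀ i : ℕ, AlgLE c (a₁ + c + m + i • b) := fun i => ⟨a₁ + m + i • b, by abel⟩
      rcases l with _ | l
      · obtain ⟨i, rfl⟩ : ∃ i, j = i + 1 := ⟨t, by omega⟩
        refine ⟨i, k + 1, 0, by simp; omega, by simp; omega, Or.inl (by simpa using hc i), ?_⟩
        simp [add_nsmul]
        calc c + m + (i • b + b) + k • a₀ = (b + c) + (m + i • b + k • a₀) := by abel
          _ = (a₀ + a₁ + c) + (m + i • b + k • a₀) := by rw [e]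
          _ = _ := by abel
      · refine ⟨j, k, l, by simp; omega, by simp; omega, Or.inl (by simpa using hc j), ?_⟩
        simp [add_nsmul]; abel
  · rw [AddMonoidHom.comp_apply, ← map_add]
    refine syntacticCon_mk_eq ?_
    rintro ⟨m, s, t⟩
    ext y
    constructor
    · rintro ⟨j, k, l, hs, ht, h, rfl⟩
      simp at hs ht
      refine ⟨j + 1, k, l, by simp; omega, by simp; omega, h.imp_left fun h => ?_, ?_⟩
      · refine h.trans ⟨0, ?_⟩
        simp [add_nsmul]; abel
      · simp [add_nsmul]; abel
    · rintro ⟨j, k, l, hs, ht, h, rfl⟩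
      simp at hs ht
      rcases j with _ | j
      · obtain ⟨k, rfl⟩ : ∃ i, k = i + 1 := ⟨s, by omega⟩
        obtain ⟨l, rfl⟩ : ∃ i, l = i + 1 := ⟨t, by omega⟩
        have hc : AlgLE c m := by simpa using h
        refine ⟨0, k, l, by simp; omega, by simp; omega, Or.inl ?_, ?_⟩
        · refine hc.trans ⟨b, ?_⟩
          simp; abel
        · obtain ⟨d, rfl⟩ := hc
          simp [add_nsmul]
          calc c + d + (k • a₀ + a₀) + (l • a₁ + a₁)
              = (a₀ + a₁ + c) + (d + k • a₀ + l • a₁) := by abel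
            _ = (b + c) + (d + k • a₀ + l • a₁) := by rw [e]
            _ = _ := by abel
      · refine ⟨j, k, l, by simp; omega, by simp; omega, h.imp_left fun h => ?_, ?_⟩
        · refine h.trans ⟨0, ?_⟩
          simp [add_nsmul]; abel
        · simp [add_nsmul]; abel

/-- The values in `M` to which a formal sum with refinement terms reduces. -/
def refineValues (a₀ a₁ b₀ b₁ : M) (f : M × (ℕ × ℕ) × (ℕ × ℕ)) : Set M :=
  {y | ∃ i₀ i₁ j₀ j₁, f.2 = ((i₀ + j₀, i₀ + j₁), (i₁ + j₀, i₁ + j₁)) ∧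
    y = f.1 + i₀ • a₀ + i₁ • a₁ + j₀ • b₀ + j₁ • b₁}

theorem exists_solves_refine (a₀ a₁ b₀ b₁ : M) :
    ∃ (E : Type u) (_ : AddCommMonoid E) (f : M →+ E),
      Reflects f ∧ Solves f (.refine a₀ a₁ b₀ b₁) := by
  refine ⟨_, inferInstance,
    (syntacticCon (refineValues a₀ a₁ b₀ b₁)).mk'.comp (AddMonoidHom.inl M _),
    reflects_syntacticCon ?_ ?_, ?_⟩
  · intro y
    exact ⟨0, 0, 0, 0, rfl, by simp⟩
  · rintro x ⟨m, n⟩ y ⟨i₀, i₁, j₀, j₁, -, rfl⟩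
    exact ⟨m + i₀ • a₀ + i₁ • a₁ + j₀ • b₀ + j₁ • b₁, by simp [add_assoc]⟩
  intro e
  refine ⟨(syntacticCon (refineValues a₀ a₁ b₀ b₁)).mk' (0, (1, 0), (0, 0)),
    (syntacticCon (refineValues a₀ a₁ b₀ b₁)).mk' (0, (0, 1), (0, 0)),
    (syntacticCon (refineValues a₀ a₁ b₀ b₁)).mk' (0, (0, 0), (1, 0)),
    (syntacticCon (refineValues a₀ a₁ b₀ b₁)).mk' (0, (0, 0), (0, 1)), ?_, ?_, ?_, ?_⟩ <;>
  rw [AddMonoidHom.comp_apply, ← map_add] <;>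
  refine syntacticCon_mk_eq ?_ <;>
  rintro ⟨m, ⟨n₀₀, n₀₁⟩, ⟨n₁₀, n₁₁⟩⟩ <;>
  ext y <;>
  constructor <;>
  rintro ⟨i₀, i₁, j₀, j₁, h, rfl⟩ <;>
  simp at h <;>
  obtain ⟨⟨h₁, h₂⟩, h₃, h₄⟩ := h
  · exact ⟨i₀ + 1, i₁, j₀, j₁, by simp; omega, by simp [add_nsmul]; abel⟩
  · rcases i₀ with _ | i₀
    · obtain ⟨j₀, rfl⟩ : ∃ i, j₀ = i + 1 := ⟨n₀₀, by omega⟩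
      obtain ⟨j₁, rfl⟩ : ∃ i, j₁ = i + 1 := ⟨n₀₁, by omega⟩
      refine ⟨0, i₁ + 1, j₀, j₁, by simp; omega, ?_⟩
      simp [add_nsmul]
      calc m + i₁ • a₁ + (j₀ • b₀ + b₀) + (j₁ • b₁ + b₁)
          = (b₀ + b₁) + (m + i₁ • a₁ + j₀ • b₀ + j₁ • b₁) := by abel
        _ = (a₀ + a₁) + (m + i₁ • a₁ + j₀ • b₀ + j₁ • b₁) := by rw [e]
        _ = _ := by abel
    · exact ⟨i₀, i₁, j₀, j₁, by simp; omega, by simp [add_nsmul]; abel⟩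
  · exact ⟨i₀, i₁ + 1, j₀, j₁, by simp; omega, by simp [add_nsmul]; abel⟩
  · rcases i₁ with _ | i₁
    · obtain ⟨j₀, rfl⟩ : ∃ i, j₀ = i + 1 := ⟨n₁₀, by omega⟩
      obtain ⟨j₁, rfl⟩ : ∃ i, j₁ = i + 1 := ⟨n₁₁, by omega⟩
      refine ⟨i₀ + 1, 0, j₀, j₁, by simp; omega, ?_⟩
      simp [add_nsmul]
      calc m + i₀ • a₀ + (j₀ • b₀ + b₀) + (j₁ • b₁ + b₁)
          = (b₀ + b₁) + (m + i₀ • a₀ + j₀ • b₀ + j₁ • b₁) := by abel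
        _ = (a₀ + a₁) + (m + i₀ • a₀ + j₀ • b₀ + j₁ • b₁) := by rw [e]
        _ = _ := by abel
    · exact ⟨i₀, i₁, j₀, j₁, by simp; omega, by simp [add_nsmul]; abel⟩
  · exact ⟨i₀, i₁, j₀ + 1, j₁, by simp; omega, by simp [add_nsmul]; abel⟩
  · rcases j₀ with _ | j₀
    · obtain ⟨i₀, rfl⟩ : ∃ i, i₀ = i + 1 := ⟨n₀₀, by omega⟩
      obtain ⟨i₁, rfl⟩ : ∃ i, i₁ = i + 1 := ⟨n₁₀, by omega⟩
      refine ⟨i₀, i₁, 0, j₁ + 1, by simp; omega, ?_⟩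
      simp [add_nsmul]
      calc m + (i₀ • a₀ + a₀) + (i₁ • a₁ + a₁) + j₁ • b₁
          = (a₀ + a₁) + (m + i₀ • a₀ + i₁ • a₁ + j₁ • b₁) := by abel
        _ = (b₀ + b₁) + (m + i₀ • a₀ + i₁ • a₁ + j₁ • b₁) := by rw [e]
        _ = _ := by abel
    · exact ⟨i₀, i₁, j₀, j₁, by simp; omega, by simp [add_nsmul]; abel⟩
  · exact ⟨i₀, i₁, j₀, j₁ + 1, by simp; omega, by simp [add_nsmul]; abel⟩
  · rcases j₁ with _ | j₁
    · obtain ⟨i₀, rfl⟩ : ∃ i, i₀ = i + 1 := ⟨n₀₁, by omega⟩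
      obtain ⟨i₁, rfl⟩ : ∃ i, i₁ = i + 1 := ⟨n₁₁, by omega⟩
      refine ⟨i₀, i₁, j₀ + 1, 0, by simp; omega, ?_⟩
      simp [add_nsmul]
      calc m + (i₀ • a₀ + a₀) + (i₁ • a₁ + a₁) + j₀ • b₀
          = (a₀ + a₁) + (m + i₀ • a₀ + i₁ • a₁ + j₀ • b₀) := by abel
        _ = (b₀ + b₁) + (m + i₀ • a₀ + i₁ • a₁ + j₀ • b₀) := by rw [e]
        _ = _ := by abel
    · exact ⟨i₀, i₁, j₀, j₁, by simp; omega, by simp [add_nsmul]; abel⟩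

theorem exists_solves (q : Problem M) :
    ∃ (E : Type u) (_ : AddCommMonoid E) (f : M →+ E),
      IsAntisymmetric E ∧ Reflects f ∧ Solves f q := by
  obtain ⟨E, _, f, hf, hq⟩ : ∃ (E : Type u) (_ : AddCommMonoid E) (f : M →+ E),
      Reflects f ∧ Solves f q := by
    cases q with
    | refine a₀ a₁ b₀ b₁ => exact exists_solves_refine a₀ a₁ b₀ b₁
    | divide p a => exact exists_solves_divide p a
    | decompose a₀ a₁ b c => exact exists_solves_decompose a₀ a₁ b c
  exact ⟨_, inferInstance, (antisymmCon E).mk'.comp f, isAntisymmetric_antisymmCon,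
    reflects_antisymmCon.comp hf, hq.comp_left _⟩

end OneStep

section ReducedProduct

open Filter

variable {ι : Type u} (l : Filter ι) (E : ι → Type u) [∀ i, AddCommMonoid (E i)]

/-- The congruence of eventual equality on a product. -/
def eventuallyEqCon : AddCon (∀ i, E i) where
  r f g := ∀ᶠ i in l, f i = g i
  iseqv := ⟨fun _ => Eventually.of_forall fun _ => rfl, fun h => h.mono fun _ => Eq.symm,
    fun h k => (h.and k).mono fun _ e => e.1.trans e.2⟩
  add' h k := (h.and k).mono fun i e => by simp [e.1, e.2]

variable {l E}

theorem eventuallyEqCon_mk_eq {f g : ∀ i, E i} :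
    (eventuallyEqCon l E).mk' f = (eventuallyEqCon l E).mk' g ↔ ∀ᶠ i in l, f i = g i :=
  (eventuallyEqCon l E).eq

theorem algLE_eventuallyEqCon_mk {f g : ∀ i, E i}
    (h : AlgLE ((eventuallyEqCon l E).mk' f) ((eventuallyEqCon l E).mk' g)) :
    ∀ᶠ i in l, AlgLE (f i) (g i) := by
  obtain ⟨z, hz⟩ := h
  obtain ⟨z, rfl⟩ := AddCon.mk'_surjective z
  rw [← map_add, eventuallyEqCon_mk_eq] at hz
  exact hz.mono fun i e => ⟨z i, e⟩

theorem isAntisymmetric_eventuallyEqCon (hE : ∀ i, IsAntisymmetric (E i)) :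
    IsAntisymmetric (eventuallyEqCon l E).Quotient := by
  intro x y hxy hyx
  obtain ⟨x, rfl⟩ := AddCon.mk'_surjective x
  obtain ⟨y, rfl⟩ := AddCon.mk'_surjective y
  exact eventuallyEqCon_mk_eq.2 (((algLE_eventuallyEqCon_mk hxy).and
    (algLE_eventuallyEqCon_mk hyx)).mono fun i h => hE i _ _ h.1 h.2)

variable {M : Type u} [AddCommMonoid M]

theorem reflects_eventuallyEqCon [l.NeBot] {f : ∀ i, M →+ E i} (hf : ∀ i, Reflects (f i)) :
    Reflects ((eventuallyEqCon l E).mk'.comp (AddMonoidHom.pi f)) := fun x y h => by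
  obtain ⟨i, hi⟩ := (algLE_eventuallyEqCon_mk h).exists
  exact hf i x y hi

theorem solves_eventuallyEqCon {f : ∀ i, M →+ E i} {q : Problem M}
    (h : ∀ᶠ i in l, Solves (f i) q) :
    Solves ((eventuallyEqCon l E).mk'.comp (AddMonoidHom.pi f)) q := by
  cases q with
  | refine a₀ a₁ b₀ b₁ =>
    intro e
    have h' : ∀ i, ∃ c₀₀ c₀₁ c₁₀ c₁₁ : E i, Solves (f i) (.refine a₀ a₁ b₀ b₁) →
        f i a₀ = c₀₀ + c₀₁ ∧ f i a₁ = c₁₀ + c₁₁ ∧ f i b₀ = c₀₀ + c₁₀ ∧ f i b₁ = c₀₁ + c₁₁ := by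
      intro i
      by_cases hi : Solves (f i) (.refine a₀ a₁ b₀ b₁)
      · obtain ⟨c₀₀, c₀₁, c₁₀, c₁₁, hc⟩ := hi e
        exact ⟨c₀₀, c₀₁, c₁₀, c₁₁, fun _ => hc⟩
      · exact ⟨0, 0, 0, 0, fun h => absurd h hi⟩
    choose c₀₀ c₀₁ c₁₀ c₁₁ hc using h'
    refine ⟨(eventuallyEqCon l E).mk' c₀₀, (eventuallyEqCon l E).mk' c₀₁,
      (eventuallyEqCon l E).mk' c₁₀, (eventuallyEqCon l E).mk' c₁₁, ?_, ?_, ?_, ?_⟩ <;>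
    rw [AddMonoidHom.comp_apply, ← map_add, eventuallyEqCon_mk_eq]
    exacts [h.mono fun i hi => (hc i hi).1, h.mono fun i hi => (hc i hi).2.1,
      h.mono fun i hi => (hc i hi).2.2.1, h.mono fun i hi => (hc i hi).2.2.2]
  | divide p a =>
    intro hp
    have h' : ∀ i, ∃ u : E i, Solves (f i) (.divide p a) →
        p • u = f i a ∧ ∀ x y : M, x + a = y + a → f i x + u = f i y + u := by
      intro i
      by_cases hi : Solves (f i) (.divide p a)
      · obtain ⟨u, hu⟩ := hi hp
        exact ⟨u, fun _ => hu⟩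
      · exact ⟨0, fun h => absurd h hi⟩
    choose u hu using h'
    refine ⟨(eventuallyEqCon l E).mk' u, ?_, fun x y hxy => ?_⟩
    · rw [AddMonoidHom.comp_apply, ← map_nsmul, eventuallyEqCon_mk_eq]
      exact h.mono fun i hi => (hu i hi).1
    · rw [AddMonoidHom.comp_apply, AddMonoidHom.comp_apply, ← map_add, ← map_add,
        eventuallyEqCon_mk_eq]
      exact h.mono fun i hi => (hu i hi).2 x y hxy
  | decompose a₀ a₁ b c =>
    intro e
    have h' : ∀ i, ∃ x₀ x₁ : E i, Solves (f i) (.decompose a₀ a₁ b c) →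
        f i a₀ + f i c = x₀ + f i c ∧ f i a₁ + f i c = x₁ + f i c ∧ f i b = x₀ + x₁ := by
      intro i
      by_cases hi : Solves (f i) (.decompose a₀ a₁ b c)
      · obtain ⟨x₀, x₁, hx⟩ := hi e
        exact ⟨x₀, x₁, fun _ => hx⟩
      · exact ⟨0, 0, fun h => absurd h hi⟩
    choose x₀ x₁ hx using h'
    exact ⟨(eventuallyEqCon l E).mk' x₀, (eventuallyEqCon l E).mk' x₁,
      eventuallyEqCon_mk_eq.2 (h.mono fun i hi => (hx i hi).1),
      eventuallyEqCon_mk_eq.2 (h.mono fun i hi => (hx i hi).2.1),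
      eventuallyEqCon_mk_eq.2 (h.mono fun i hi => (hx i hi).2.2)⟩

end ReducedProduct

section AllProblems

variable {M : Type u} [AddCommMonoid M]

theorem exists_solves_finset (hM : IsAntisymmetric M) (s : Finset (Problem M)) :
    ∃ (E : Type u) (_ : AddCommMonoid E) (f : M →+ E),
      IsAntisymmetric E ∧ Reflects f ∧ ∀ q ∈ s, Solves f q := by
  classical
  induction s using Finset.induction_on with
  | empty => exact ⟨M, inferInstance, AddMonoidHom.id M, hM, fun _ _ h => h, by simp⟩
  | insert q s _ ih =>
    obtain ⟨E, _, f, -, hf, hs⟩ := ih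
    obtain ⟨E', _, g, hE', hg, hq⟩ := exists_solves (q.map f)
    refine ⟨E', inferInstance, g.comp f, hE', hg.comp hf, fun r hr => ?_⟩
    obtain rfl | hr := Finset.mem_insert.1 hr
    · exact hq.comp_right f
    · exact (hs r hr).comp_left g

theorem exists_solves_all (hM : IsAntisymmetric M) :
    ∃ (E : Type u) (_ : AddCommMonoid E) (f : M →+ E),
      IsAntisymmetric E ∧ Reflects f ∧ ∀ q, Solves f q := by
  choose E _ f hE hf hs using exists_solves_finset hM
  refine ⟨_, inferInstance, (eventuallyEqCon Filter.atTop E).mk'.comp (AddMonoidHom.pi f),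
    isAntisymmetric_eventuallyEqCon hE, reflects_eventuallyEqCon hf,
    fun q => solves_eventuallyEqCon ?_⟩
  filter_upwards [Filter.eventually_ge_atTop {q}] with s hq
  exact hs s q (Finset.singleton_subset_iff.1 hq)

end AllProblems

section SequentialLimit

variable {G : ℕ → Type u} [∀ n, AddCommMonoid (G n)]

/-- The composite transition homomorphisms of a sequence of homomorphisms. -/
def transition (f : ∀ n, G n →+ G (n + 1)) (m n : ℕ) (h : m ≤ n) : G m →+ G n :=
  Nat.leRec (motive := fun n _ => G m →+ G n) (AddMonoidHom.id _) (fun n _ g => (f n).comp g) h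

variable (f : ∀ n, G n →+ G (n + 1))

theorem transition_self (n : ℕ) : transition f n n le_rfl = AddMonoidHom.id _ :=
  Nat.leRec_self _ _

theorem transition_succ (m n : ℕ) (h : m ≤ n) :
    transition f m (n + 1) (h.trans n.le_succ) = (f n).comp (transition f m n h) :=
  Nat.leRec_succ _ _ _

theorem transition_trans (k m n : ℕ) (hkm : k ≤ m) (hmn : m ≤ n) :
    transition f k n (hkm.trans hmn) = (transition f m n hmn).comp (transition f k m hkm) := by
  induction n, hmn using Nat.le_induction with
  | base => rw [transition_self, AddMonoidHom.id_comp]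
  | succ n hmn ih =>
    rw [transition_succ f k n (hkm.trans hmn), ih, transition_succ f m n hmn,
      AddMonoidHom.comp_assoc]

instance transition_directedSystem :
    DirectedSystem G fun m n h => transition f m n h where
  map_self n x := by rw [transition_self]; rfl
  map_map n m k hkm hmn x := by rw [transition_trans f _ _ _ hkm hmn]; rfl

theorem reflects_transition (hf : ∀ n, Reflects (f n)) (m n : ℕ) (h : m ≤ n) :
    Reflects (transition f m n h) := by
  induction n, h using Nat.le_induction with
  | base => rw [transition_self]; exact fun _ _ h => h
  | succ n h ih => rw [transition_succ f m n h]; exact (hf n).comp ih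

/-- The canonical homomorphism into the direct limit. -/
def toLimit (n : ℕ) : G n →+ DirectLimit G (transition f) where
  toFun x := ⟦⟨n, x⟩⟧
  map_zero' := (DirectLimit.zero_def n).symm
  map_add' x y := (DirectLimit.add_def n x y).symm

theorem toLimit_transition (m n : ℕ) (h : m ≤ n) (x : G m) :
    toLimit f n (transition f m n h x) = toLimit f m x :=
  DirectLimit.mk_apply m n x h

theorem toLimit_comp_succ (n : ℕ) : (toLimit f (n + 1)).comp (f n) = toLimit f n := by
  ext x
  rw [← toLimit_transition f n (n + 1) n.le_succ x, transition_succ f n n le_rfl, transition_self]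
  rfl

theorem exists_toLimit_finset (s : Finset (DirectLimit G (transition f))) :
    ∃ n, ∀ m, n ≤ m → ∀ x ∈ s, x ∈ Set.range (toLimit f m) := by
  classical
  induction s using Finset.induction_on with
  | empty => exact ⟨0, by simp⟩
  | insert x s _ ih =>
    obtain ⟨n, hn⟩ := ih
    obtain ⟨k, x, rfl⟩ := DirectLimit.exists_eq_mk (transition f) x
    refine ⟨max n k, fun m hm y hy => ?_⟩
    obtain rfl | hy := Finset.mem_insert.1 hy
    · exact ⟨transition f k m (le_of_max_le_right hm) x, toLimit_transition f k m _ x⟩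
    · exact hn m (le_of_max_le_left hm) y hy

variable {f}

theorem reflects_toLimit (hf : ∀ n, Reflects (f n)) (n : ℕ) : Reflects (toLimit f n) := by
  rintro x y ⟨z, hz⟩
  obtain ⟨k, hk⟩ := exists_toLimit_finset f {z}
  obtain ⟨z, rfl⟩ := hk (max n k) (le_max_right _ _) z (Finset.mem_singleton_self z)
  rw [← toLimit_transition f n (max n k) (le_max_left _ _) x,
    ← toLimit_transition f n (max n k) (le_max_left _ _) y, ← map_add] at hz
  obtain ⟨i, hi, hi', e⟩ := Quotient.exact hz
  refine reflects_transition f hf n (max n k) (le_max_left _ _) x y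
    (reflects_transition f hf _ i hi _ _ ⟨transition f _ i hi z, ?_⟩)
  rw [← map_add]
  exact e

theorem exists_toLimit_eq₂ (x y : DirectLimit G (transition f)) :
    ∃ n a b, toLimit f n a = x ∧ toLimit f n b = y := by
  classical
  obtain ⟨n, hn⟩ := exists_toLimit_finset f {x, y}
  obtain ⟨a, ha⟩ := hn n le_rfl x (by simp)
  obtain ⟨b, hb⟩ := hn n le_rfl y (by simp)
  exact ⟨n, a, b, ha, hb⟩

theorem exists_toLimit_eq₄ (x y z w : DirectLimit G (transition f)) :
    ∃ n a b c d, toLimit f n a = x ∧ toLimit f n b = y ∧ toLimit f n c = z ∧ toLimit f n d = w := by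
  classical
  obtain ⟨n, hn⟩ := exists_toLimit_finset f {x, y, z, w}
  obtain ⟨a, ha⟩ := hn n le_rfl x (by simp)
  obtain ⟨b, hb⟩ := hn n le_rfl y (by simp)
  obtain ⟨c, hc⟩ := hn n le_rfl z (by simp)
  obtain ⟨d, hd⟩ := hn n le_rfl w (by simp)
  exact ⟨n, a, b, c, d, ha, hb, hc, hd⟩

theorem isAntisymmetric_limit (hG : ∀ n, IsAntisymmetric (G n)) (hf : ∀ n, Reflects (f n)) :
    IsAntisymmetric (DirectLimit G (transition f)) := by
  intro x y hxy hyx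
  obtain ⟨n, x, y, rfl, rfl⟩ := exists_toLimit_eq₂ x y
  rw [hG n x y (reflects_toLimit hf n x y hxy) (reflects_toLimit hf n y x hyx)]

theorem solves_toLimit (hs : ∀ n q, Solves (f n) q) (n : ℕ) (q : Problem (G n)) :
    Solves (toLimit f n) q := by
  rw [← toLimit_comp_succ f n]
  exact (hs n q).comp_left _

theorem isRefinementMonoid_limit (hG : ∀ n, IsAntisymmetric (G n)) (hf : ∀ n, Reflects (f n))
    (hs : ∀ n q, Solves (f n) q) :
    IsRefinementMonoid (DirectLimit G (transition f)) := by
  intro a₀ a₁ b₀ b₁ e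
  obtain ⟨n, a₀, a₁, b₀, b₁, rfl, rfl, rfl, rfl⟩ := exists_toLimit_eq₄ a₀ a₁ b₀ b₁
  rw [← map_add, ← map_add] at e
  exact solves_toLimit hs n (.refine a₀ a₁ b₀ b₁) ((reflects_toLimit hf n).injective (hG n) e)

theorem wsd_limit (hG : ∀ n, IsAntisymmetric (G n)) (hf : ∀ n, Reflects (f n))
    (hs : ∀ n q, Solves (f n) q) :
    WSD (DirectLimit G (transition f)) := by
  intro a₀ a₁ b c e
  obtain ⟨n, a₀, a₁, b, c, rfl, rfl, rfl, rfl⟩ := exists_toLimit_eq₄ a₀ a₁ b c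
  simp only [← map_add] at e
  exact solves_toLimit hs n (.decompose a₀ a₁ b c) ((reflects_toLimit hf n).injective (hG n) e)

theorem isNormallyDivisible_limit (hG : ∀ n, IsAntisymmetric (G n)) (hf : ∀ n, Reflects (f n))
    (hs : ∀ n q, Solves (f n) q) :
    IsNormallyDivisible (DirectLimit G (transition f)) := by
  classical
  intro p hp X a
  obtain ⟨n, hn⟩ := exists_toLimit_finset f (insert a X)
  obtain ⟨a, rfl⟩ := hn n le_rfl a (Finset.mem_insert_self a X)
  obtain ⟨u, hu, h⟩ := solves_toLimit hs n (.divide p a) hp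
  refine ⟨u, hu, fun x hx y hy e => ?_⟩
  obtain ⟨x, rfl⟩ := hn n le_rfl x (Finset.mem_insert_of_mem hx)
  obtain ⟨y, rfl⟩ := hn n le_rfl y (Finset.mem_insert_of_mem hy)
  rw [← map_add, ← map_add] at e
  exact h x y ((reflects_toLimit hf n).injective (hG n) e)

end SequentialLimit

/-- A commutative monoid with antisymmetric algebraic preorder, bundled. -/
structure AntisymmetricMonoid where
  /-- The underlying type. -/
  carrier : Type u
  [addCommMonoid : AddCommMonoid carrier]
  isAntisymmetric : IsAntisymmetric carrier

attribute [instance] AntisymmetricMonoid.addCommMonoid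

theorem exists_reflects_isRefinementMonoid (M : Type u) [AddCommMonoid M]
    (hM : IsAntisymmetric M) :
    ∃ (R : Type u) (_ : AddCommMonoid R) (f : M →+ R), IsAntisymmetric R ∧ Reflects f ∧
      IsRefinementMonoid R ∧ IsNormallyDivisible R ∧ WSD R := by
  have step : ∀ A : AntisymmetricMonoid.{u}, ∃ (B : AntisymmetricMonoid.{u})
      (f : A.carrier →+ B.carrier), Reflects f ∧ ∀ q, Solves f q := by
    intro A
    obtain ⟨E, _, f, hE, hf⟩ := exists_solves_all A.isAntisymmetric
    exact ⟨⟨E, hE⟩, f, hf⟩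
  choose next f hf hs using step
  let A : ℕ → AntisymmetricMonoid.{u} := fun n =>
    Nat.rec (motive := fun _ => AntisymmetricMonoid.{u}) ⟨M, hM⟩ (fun _ => next) n
  let F : ∀ n, (A n).carrier →+ (A (n + 1)).carrier := fun n => f (A n)
  have hA : ∀ n, IsAntisymmetric (A n).carrier := fun n => (A n).isAntisymmetric
  have hF : ∀ n, Reflects (F n) := fun n => hf (A n)
  have hS : ∀ n q, Solves (F n) q := fun n => hs (A n)
  exact ⟨DirectLimit (fun n => (A n).carrier) (transition F), inferInstance, toLimit F 0,
    isAntisymmetric_limit hA hF, reflects_toLimit hF 0, isRefinementMonoid_limit hA hF hS,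
    isNormallyDivisible_limit hA hF hS, wsd_limit hA hF hS⟩

section Units

variable {R : Type u} [AddCommMonoid R]

theorem Propto.nsmul {a b : R} (n : ℕ) (hn : 0 < n) (h : Propto a b) : Propto a (n • b) := by
  obtain ⟨m, hm, h⟩ := h
  refine ⟨m, hm, h.trans (AlgLE.nsmul m ?_)⟩
  obtain ⟨k, rfl⟩ : ∃ k, n = k + 1 := Nat.exists_eq_succ_of_ne_zero hn.ne'
  rw [succ_nsmul']
  exact algLE_add_right b _

theorem propto_nsmul_self (a : R) (n : ℕ) (hn : 0 < n) : Propto (n • a) a :=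
  ⟨n, hn, algLE_refl _⟩

theorem Propto.add {a b e : R} (ha : Propto a e) (hb : Propto b e) : Propto (a + b) e := by
  obtain ⟨m, hm, ha⟩ := ha
  obtain ⟨n, hn, hb⟩ := hb
  exact ⟨m + n, by omega, by rw [add_nsmul]; exact ha.add hb⟩

theorem Asymp.add_propto {a b e : R} (ha : Asymp a e) (hb : Propto b e) : Asymp (a + b) e :=
  ⟨ha.1.add hb, ha.2.trans (algLE_add_right a b).propto⟩

theorem Asymp.propto_add {a b e : R} (ha : Propto a e) (hb : Asymp b e) : Asymp (a + b) e := by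
  rw [add_comm]
  exact hb.add_propto ha

theorem Propto.of_add_left {a b e : R} (h : Propto (a + b) e) : Propto a e :=
  (algLE_add_right a b).propto.trans h

theorem Propto.of_add_right {a b e : R} (h : Propto (a + b) e) : Propto b e :=
  (algLE_add_left b a).propto.trans h

/-- In a refinement monoid, an element below a multiple of `b` is below a multiple of a common
lower bound with `b`. -/
theorem IsRefinementMonoid.exists_lower_bound (hR : IsRefinementMonoid R) (n : ℕ) :
    ∀ a b : R, AlgLE a (n • b) → ∃ w, AlgLE w a ∧ AlgLE w b ∧ AlgLE a (n • w) := by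
  induction n with
  | zero =>
    intro a b h
    exact ⟨0, ⟨a, zero_add a⟩, ⟨b, zero_add b⟩, by simpa using h⟩
  | succ n ih =>
    rintro a b ⟨z, hz⟩
    rw [succ_nsmul] at hz
    obtain ⟨c₀₀, c₀₁, c₁₀, s, rfl, rfl, h, hb⟩ := hR _ _ _ _ hz
    obtain ⟨w, hw, ⟨r, hr⟩, hn⟩ := ih c₀₀ b ⟨c₁₀, h.symm⟩
    obtain ⟨p, q, p', q', rfl, rfl, rfl, rfl⟩ := hR _ _ _ _ (hr.trans hb)
    refine ⟨p + q + p', ?_, ⟨q', by rw [← hr]; abel⟩, ?_⟩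
    · obtain ⟨t, rfl⟩ := hw
      exact ⟨t + p, by abel⟩
    · obtain ⟨t, ht⟩ := hn
      refine ⟨t + q + n • p', ?_⟩
      rw [succ_nsmul, nsmul_add, ← ht]
      abel

/-- In a refinement monoid, elements asymptotic to `e` have a common lower bound asymptotic to
`e`. -/
theorem IsRefinementMonoid.exists_asymp_lower_bound (hR : IsRefinementMonoid R) {a b e : R}
    (ha : Asymp a e) (hb : Asymp b e) : ∃ w, Asymp w e ∧ AlgLE w a ∧ AlgLE w b := by
  obtain ⟨n, hn, h⟩ := ha.1.trans hb.2
  obtain ⟨w, hwa, hwb, haw⟩ := hR.exists_lower_bound n a b h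
  exact ⟨w, ⟨hwa.propto.trans ha.1, ha.2.trans ⟨n, hn, haw⟩⟩, hwa, hwb⟩

theorem IsNormallyDivisible.exists_asymp (hR : IsNormallyDivisible R) (p : ℕ) (hp : 0 < p)
    (X : Finset R) {a e : R} (ha : Asymp a e) : ∃ u, Asymp u e ∧ p • u = a ∧
      ∀ x ∈ X, ∀ y ∈ X, x + a = y + a → x + u = y + u := by
  obtain ⟨u, rfl, hu⟩ := hR p hp X a
  exact ⟨u, ⟨((algLE_refl u).propto.nsmul p hp).trans ha.1,
    ha.2.trans (propto_nsmul_self u p hp)⟩, rfl, hu⟩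

theorem exists_refinement_asymp (hR : IsRefinementMonoid R) (hD : IsNormallyDivisible R)
    {e a₀ a₁ b₀ b₁ : R} (ha₀ : Asymp a₀ e) (ha₁ : Asymp a₁ e) (hb₀ : Asymp b₀ e)
    (hb₁ : Asymp b₁ e) (h : a₀ + a₁ = b₀ + b₁) :
    ∃ c₀₀ c₀₁ c₁₀ c₁₁ : R, (Asymp c₀₀ e ∧ Asymp c₀₁ e ∧ Asymp c₁₀ e ∧ Asymp c₁₁ e) ∧
      a₀ = c₀₀ + c₀₁ ∧ a₁ = c₁₀ + c₁₁ ∧ b₀ = c₀₀ + c₁₀ ∧ b₁ = c₀₁ + c₁₁ := by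
  classical
  obtain ⟨w, hw, ⟨y, rfl⟩, ⟨z, rfl⟩⟩ := hR.exists_asymp_lower_bound ha₀ hb₀
  obtain ⟨u, hu, rfl, hX⟩ := hD.exists_asymp 5 (by norm_num) {y + a₁, z + b₁} hw
  have key : y + a₁ + u = z + b₁ + u := by
    refine hX _ (by simp) _ (by simp) ?_
    calc y + a₁ + 5 • u = 5 • u + y + a₁ := by abel
      _ = 5 • u + z + b₁ := h
      _ = _ := by abel
  obtain ⟨w₁, hw₁, hwu, hwa⟩ := hR.exists_asymp_lower_bound hu ha₁
  obtain ⟨w₂, hw₂, hww, hwb⟩ := hR.exists_asymp_lower_bound hw₁ hb₁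
  obtain ⟨v, hv, rfl, -⟩ := hD.exists_asymp 2 (by norm_num) ∅ hw₂
  obtain ⟨d, rfl⟩ := hww.trans hwu
  obtain ⟨a₁, rfl⟩ := hww.trans hwa
  obtain ⟨b₁, rfl⟩ := hwb
  have e₁ : (8 • v + 5 • d + y) + a₁ = (8 • v + 5 • d + z) + b₁ := by
    calc (8 • v + 5 • d + y) + a₁
        = (y + (2 • v + a₁) + (2 • v + d)) + (4 • v + 4 • d) := by abel
      _ = (z + (2 • v + b₁) + (2 • v + d)) + (4 • v + 4 • d) := by rw [key]
      _ = _ := by abel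
  obtain ⟨c₀₀, c₀₁, c₁₀, c₁₁, h₁, h₂, h₃, h₄⟩ := hR _ _ _ _ e₁
  have hc₀ : Propto (c₀₀ + c₀₁) e := by
    rw [← h₁]
    refine (AlgLE.propto ⟨2 • v, ?_⟩).trans ha₀.1
    abel
  have hc₁ : Propto (c₁₀ + c₁₁) e := by
    rw [← h₂]
    exact ha₁.1.of_add_right
  refine ⟨v + c₀₀, v + c₀₁, v + c₁₀, v + c₁₁, ⟨hv.add_propto hc₀.of_add_left,
    hv.add_propto hc₀.of_add_right, hv.add_propto hc₁.of_add_left,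
    hv.add_propto hc₁.of_add_right⟩, ?_, ?_, ?_, ?_⟩
  · calc 5 • (2 • v + d) + y = 2 • v + (8 • v + 5 • d + y) := by abel
      _ = _ := by rw [h₁]; abel
  · rw [h₂]; abel
  · calc 5 • (2 • v + d) + z = 2 • v + (8 • v + 5 • d + z) := by abel
      _ = _ := by rw [h₃]; abel
  · rw [h₄]; abel

theorem exists_weak_decomposition_asymp (hR : IsRefinementMonoid R) (hD : IsNormallyDivisible R)
    (hW : WSD R) {e a₀ a₁ b c : R} (ha₀ : Asymp a₀ e) (ha₁ : Asymp a₁ e) (hb : Asymp b e)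
    (h : a₀ + a₁ + c = b + c) :
    ∃ x₀ x₁ : R, (Asymp x₀ e ∧ Asymp x₁ e) ∧ a₀ + c = x₀ + c ∧ a₁ + c = x₁ + c ∧ b = x₀ + x₁ := by
  classical
  obtain ⟨w, hw, ⟨y, rfl⟩, ⟨z, rfl⟩⟩ := hR.exists_asymp_lower_bound ha₀ hb
  obtain ⟨u, hu, rfl, hX⟩ := hD.exists_asymp 3 (by norm_num) {y + a₁ + c, z + c} hw
  have key : y + a₁ + c + u = z + c + u := by
    refine hX _ (by simp) _ (by simp) ?_
    calc y + a₁ + c + 3 • u = 3 • u + y + a₁ + c := by abel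
      _ = 3 • u + z + c := h
      _ = _ := by abel
  obtain ⟨v, hv, ⟨d, rfl⟩, ⟨a₁, rfl⟩⟩ := hR.exists_asymp_lower_bound hu ha₁
  have e₁ : (2 • (v + d) + y) + a₁ + c = (d + (v + d) + z) + c := by
    calc (2 • (v + d) + y) + a₁ + c = (y + (v + a₁) + c + (v + d)) + d := by abel
      _ = (z + c + (v + d)) + d := by rw [key]
      _ = _ := by abel
  obtain ⟨x₀, x₁, h₀, h₁, h₂⟩ := hW _ _ _ _ e₁
  have hx : Propto (x₀ + x₁) e := by
    rw [← h₂]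
    refine (AlgLE.propto ⟨v + (v + d), ?_⟩).trans hb.1
    abel
  refine ⟨(v + d) + x₀, v + x₁, ⟨hu.add_propto hx.of_add_left, hv.add_propto hx.of_add_right⟩,
    ?_, ?_, ?_⟩
  · calc 3 • (v + d) + y + c = (v + d) + (2 • (v + d) + y + c) := by abel
      _ = (v + d) + (x₀ + c) := by rw [h₀]
      _ = _ := by abel
  · rw [add_assoc, h₁, add_assoc]
  · calc 3 • (v + d) + z = (v + d) + v + (d + (v + d) + z) := by abel
      _ = _ := by rw [h₂]; abel

/-- The submonoid consisting of zero and the elements asymptotic to `e`. -/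
def asympSubmonoid (e : R) : AddSubmonoid R where
  carrier := {r | r = 0 ∨ Asymp r e}
  zero_mem' := Or.inl rfl
  add_mem' := by
    rintro a b (rfl | ha) (rfl | hb)
    · exact Or.inl (add_zero 0)
    · exact Or.inr (by rwa [zero_add])
    · exact Or.inr (by rwa [add_zero])
    · exact Or.inr (ha.add_propto hb.1)

variable {e : R}

theorem isConical_asympSubmonoid (hR : IsConical R) : IsConical (asympSubmonoid e) := by
  intro x y h
  obtain ⟨hx, hy⟩ := hR x y (by exact_mod_cast h)
  exact ⟨Subtype.ext hx, Subtype.ext hy⟩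

theorem isSimpleMonoid_asympSubmonoid : IsSimpleMonoid (asympSubmonoid e) := by
  rintro ⟨u, rfl | hu⟩ hu0 ⟨x, hx⟩
  · exact absurd (algLE_refl _) hu0
  have hxe : Propto x e := by
    obtain rfl | hx := hx
    · exact (AlgLE.propto ⟨e, zero_add e⟩)
    · exact hx.1
  obtain ⟨n, hn, t, ht⟩ := hxe.trans hu.2
  have hte : Propto t e := by
    refine Propto.of_add_right (a := x) ?_
    rw [ht]
    exact (propto_nsmul_self u n hn).trans hu.1
  refine ⟨n + 1, n.succ_pos, ⟨t + u, Or.inr (Asymp.propto_add hte hu)⟩, Subtype.ext ?_⟩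
  simp [succ_nsmul, ← ht, add_assoc]

theorem isNormallyDivisible_asympSubmonoid (hD : IsNormallyDivisible R) :
    IsNormallyDivisible (asympSubmonoid e) := by
  classical
  rintro p hp X ⟨a, rfl | ha⟩
  · exact ⟨0, nsmul_zero p, fun x _ y _ h => h⟩
  obtain ⟨u, hu, rfl, h⟩ := hD.exists_asymp p hp (X.image Subtype.val) ha
  exact ⟨⟨u, Or.inr hu⟩, Subtype.ext (by simp), fun x hx y hy hxy => Subtype.ext
    (h x (Finset.mem_image_of_mem _ hx) y (Finset.mem_image_of_mem _ hy)
      (congrArg Subtype.val hxy))⟩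

theorem isRefinementMonoid_asympSubmonoid (hC : IsConical R) (hR : IsRefinementMonoid R)
    (hD : IsNormallyDivisible R) : IsRefinementMonoid (asympSubmonoid e) := by
  have hN := isConical_asympSubmonoid (e := e) hC
  intro a₀ a₁ b₀ b₁ h
  by_cases h₁ : a₀ = 0
  · subst h₁
    exact ⟨0, 0, b₀, b₁, by simp, by simpa using h, by simp, by simp⟩
  by_cases h₂ : a₁ = 0
  · subst h₂
    exact ⟨b₀, b₁, 0, 0, by simpa using h, by simp, by simp, by simp⟩
  by_cases h₃ : b₀ = 0
  · subst h₃
    exact ⟨0, a₀, 0, a₁, by simp, by simp, by simp, by simpa using h.symm⟩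
  by_cases h₄ : b₁ = 0
  · subst h₄
    exact ⟨a₀, 0, a₁, 0, by simp, by simp, by simpa using h.symm, by simp⟩
  have unit : ∀ x : asympSubmonoid e, x ≠ 0 → Asymp (x : R) e := fun x hx =>
    x.2.resolve_left fun h => hx (Subtype.ext h)
  obtain ⟨c₀₀, c₀₁, c₁₀, c₁₁, ⟨k₁, k₂, k₃, k₄⟩, e₁, e₂, e₃, e₄⟩ := exists_refinement_asymp hR hD
    (unit _ h₁) (unit _ h₂) (unit _ h₃) (unit _ h₄) (congrArg Subtype.val h)
  exact ⟨⟨c₀₀, Or.inr k₁⟩, ⟨c₀₁, Or.inr k₂⟩, ⟨c₁₀, Or.inr k₃⟩, ⟨c₁₁, Or.inr k₄⟩, Subtype.ext e₁,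
    Subtype.ext e₂, Subtype.ext e₃, Subtype.ext e₄⟩

theorem wsd_asympSubmonoid (hC : IsConical R) (hR : IsRefinementMonoid R)
    (hD : IsNormallyDivisible R) (hW : WSD R) : WSD (asympSubmonoid e) := by
  intro a₀ a₁ b c h
  by_cases h₁ : a₀ = 0
  · subst h₁
    exact ⟨0, b, rfl, by simpa using h, by simp⟩
  by_cases h₂ : a₁ = 0
  · subst h₂
    exact ⟨b, 0, by simpa using h, rfl, by simp⟩
  by_cases h₃ : b = 0
  · subst h₃
    obtain ⟨x₀, x₁, e₀, e₁, e₂⟩ := hW _ _ _ _ (congrArg Subtype.val h)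
    obtain ⟨rfl, rfl⟩ := hC _ _ e₂.symm
    exact ⟨0, 0, Subtype.ext e₀, Subtype.ext e₁, by simp⟩
  have unit : ∀ x : asympSubmonoid e, x ≠ 0 → Asymp (x : R) e := fun x hx =>
    x.2.resolve_left fun h => hx (Subtype.ext h)
  obtain ⟨x₀, x₁, ⟨k₀, k₁⟩, e₀, e₁, e₂⟩ := exists_weak_decomposition_asymp hR hD hW
    (unit _ h₁) (unit _ h₂) (unit _ h₃) (congrArg Subtype.val h)
  exact ⟨⟨x₀, Or.inr k₀⟩, ⟨x₁, Or.inr k₁⟩, Subtype.ext e₀, Subtype.ext e₁, Subtype.ext e₂⟩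

end Units

theorem exists_forall_asymp {M : Type u} [AddCommMonoid M] (hM : IsConical M)
    (hMs : IsSimpleMonoid M) : ∃ e : M, ∀ x, x = 0 ∨ Asymp x e := by
  have unit : ∀ x : M, x ≠ 0 → ∀ y, Propto y x := fun x hx =>
    hMs x fun ⟨z, hz⟩ => hx (hM x z hz).1
  by_cases h : ∃ e : M, e ≠ 0
  · obtain ⟨e, he⟩ := h
    exact ⟨e, fun x => or_iff_not_imp_left.2 fun hx => ⟨unit e he x, unit x hx e⟩⟩
  · push Not at h
    exact ⟨0, fun x => Or.inl (h x)⟩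

/-- Every simple antisymmetric cone admits an order-embedding into a
simple normally divisible refinement cone satisfying (WSD). -/
theorem simple_antisymmetric_cone_orderEmbeds_into_WSD_cone
    (M : Type u) [AddCommMonoid M] (hM : IsConical M)
    (hanti : ∀ x y : M, AlgLE x y → AlgLE y x → x = y)
    (hMs : IsSimpleMonoid M) :
    ∃ (N : Type u) (_ : AddCommMonoid N),
      IsConical N ∧ IsSimpleMonoid N ∧ IsNormallyDivisible N ∧
      IsRefinementMonoid N ∧ WSD N ∧
      ∃ f : M →+ N, IsOrderEmbeddingHom f := by
  obtain ⟨R, _, f, hR, hf, hRef, hD, hW⟩ := exists_reflects_isRefinementMonoid M hanti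
  obtain ⟨e, he⟩ := exists_forall_asymp hM hMs
  refine ⟨asympSubmonoid (f e), inferInstance, isConical_asympSubmonoid hR.isConical,
    isSimpleMonoid_asympSubmonoid, isNormallyDivisible_asympSubmonoid hD,
    isRefinementMonoid_asympSubmonoid hR.isConical hRef hD,
    wsd_asympSubmonoid hR.isConical hRef hD hW,
    f.codRestrict _ fun x => (he x).imp (fun h => by rw [h, map_zero])
      fun h => ⟨h.1.map f, h.2.map f⟩, ?_, fun x y => ⟨AlgLE.map _, fun h => ?_⟩⟩
  · exact fun x y h => hf.injective hanti (congrArg Subtype.val h)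
  · exact hf x y (h.map (AddSubmonoid.subtype _))
end

section
/- Let A be the additive submonoid of the natural numbers generated by 2 and 7, and let M be the additive submonoid of the nonnegative rationals generated by all elements of the form (k/2)·(9/2)^n with k ∈ A and n a natural number. Then for every natural number m, the rational number (9/2)^m − 2 does not belong to M. -/
universe u

/-- The submonoid of `ℕ` generated by `2` and `7` misses `1`, `3` and `5`. -/
theorem ne_of_mem_closure_two_seven {k : ℕ}
    (hk : k ∈ AddSubmonoid.closure ({2, 7} : Set ℕ)) : k ≠ 1 ∧ k ≠ 3 ∧ k ≠ 5 := by
  suffices h : k = 0 ∨ k = 2 ∨ k = 4 ∨ 6 ≤ k by omega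
  induction hk using AddSubmonoid.closure_induction with
  | mem x hx =>
    rcases hx with rfl | rfl <;> omega
  | zero => omega
  | add x y _ _ hx hy => omega

theorem exists_two_pow_mul_sum_eq_two_mul (k : ℕ → ℕ) (m : ℕ) :
    ∃ z : ℕ, (2 : ℚ) ^ m * ∑ n ∈ Finset.range m, (k n : ℚ) * (9 / 2) ^ n = 2 * z := by
  induction m with
  | zero => exact ⟨0, by simp⟩
  | succ m ih =>
    obtain ⟨z, hz⟩ := ih
    refine ⟨2 * z + k m * 9 ^ m, ?_⟩
    have h : (2 : ℚ) ^ m * (9 / 2) ^ m = 9 ^ m := by rw [← mul_pow]; norm_num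
    rw [Finset.sum_range_succ]
    push_cast
    rw [pow_succ]
    linear_combination 2 * hz + 2 * (k m : ℚ) * h

theorem sum_mul_pow_nine_halves_ne {k : ℕ → ℕ} (hk : ∀ n, k n ≠ 1 ∧ k n ≠ 3 ∧ k n ≠ 5)
    (m : ℕ) :
    ∑ n ∈ Finset.range m, (k n : ℚ) * (9 / 2) ^ n ≠ 2 * (9 / 2) ^ m - 4 := by
  induction m with
  | zero => norm_num
  | succ m ih =>
    intro h
    rw [Finset.sum_range_succ] at h
    have hpos : (0 : ℚ) < (9 / 2) ^ m := by positivity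
    have hlt : k m < 9 := by
      have hS : 0 ≤ ∑ n ∈ Finset.range m, (k n : ℚ) * (9 / 2) ^ n :=
        Finset.sum_nonneg fun _ _ => by positivity
      have : (k m : ℚ) * (9 / 2) ^ m < 9 * (9 / 2) ^ m := by
        rw [pow_succ] at h
        linarith
      exact_mod_cast lt_of_mul_lt_mul_right this hpos.le
    have hodd : Odd (k m) := by
      obtain ⟨z, hz⟩ := exists_two_pow_mul_sum_eq_two_mul k m
      have h9 : (2 : ℚ) ^ m * (9 / 2) ^ m = 9 ^ m := by rw [← mul_pow]; norm_num
      have hnat : 2 * z + k m * 9 ^ m + 2 * (2 * 2 ^ m) = 9 * 9 ^ m := by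
        have : 2 * (z : ℚ) + k m * 9 ^ m + 2 * (2 * 2 ^ m) = 9 * 9 ^ m := by
          rw [pow_succ] at h
          linear_combination 2 ^ m * h - hz + (9 - (k m : ℚ)) * h9
        exact_mod_cast this
      have h9odd : Odd (9 * 9 ^ m : ℕ) := Odd.mul (by decide) (Odd.pow (by decide))
      rw [← hnat] at h9odd
      by_contra hc
      rw [Nat.not_odd_iff_even] at hc
      exact Nat.not_odd_iff_even.2
        (((even_two_mul z).add (hc.mul_right _)).add (even_two_mul _)) h9odd
    have h7 : k m = 7 := by
      obtain ⟨h1, h3, h5⟩ := hk m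
      obtain ⟨r, hr⟩ := hodd
      omega
    apply ih
    rw [h7, pow_succ] at h
    push_cast at h
    linarith

open Polynomial in
theorem exists_polynomial_of_mem_closure {A : AddSubmonoid ℕ} {x : ℚ}
    (hx : x ∈ AddSubmonoid.closure
      {q : ℚ | ∃ k ∈ A, ∃ n : ℕ, q = (k : ℚ) / 2 * (9 / 2) ^ n}) :
    ∃ p : ℕ[X], (∀ n, p.coeff n ∈ A) ∧ aeval (9 / 2 : ℚ) p = 2 * x := by
  induction hx using AddSubmonoid.closure_induction with
  | mem x hx =>
    obtain ⟨k, hk, n, rfl⟩ := hx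
    refine ⟨monomial n k, fun i => ?_, ?_⟩
    · rw [coeff_monomial]
      split_ifs
      exacts [hk, A.zero_mem]
    · rw [aeval_monomial, eq_natCast]
      ring
  | zero => exact ⟨0, fun i => by simp, by simp⟩
  | add x y _ _ hx hy =>
    obtain ⟨p, hp, hpx⟩ := hx
    obtain ⟨q, hq, hqy⟩ := hy
    refine ⟨p + q, fun i => ?_, ?_⟩
    · rw [coeff_add]
      exact A.add_mem (hp i) (hq i)
    · rw [map_add, hpx, hqy, mul_add]

/-- With `A` the submonoid of `ℕ` generated by `{2, 7}` and `M` the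
submonoid of the nonnegative rationals generated by the elements `(k/2)·(9/2)^n`
(`k ∈ A`, `n ∈ ℕ`), the rational `(9/2)^m - 2` never belongs to `M`. -/
theorem pow_nine_halves_sub_two_not_mem
    (A : AddSubmonoid ℕ) (hA : A = AddSubmonoid.closure {2, 7})
    (M : AddSubmonoid ℚ)
    (hM : M = AddSubmonoid.closure
      {q : ℚ | ∃ k ∈ A, ∃ n : ℕ, q = (k : ℚ) / 2 * (9 / 2) ^ n}) :
    ∀ m : ℕ, ((9 : ℚ) / 2) ^ m - 2 ∉ M := by
  intro m hmem
  subst hM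
  obtain ⟨p, hp, hpx⟩ := exists_polynomial_of_mem_closure hmem
  have hk : ∀ n, p.coeff n ≠ 1 ∧ p.coeff n ≠ 3 ∧ p.coeff n ≠ 5 := fun n =>
    ne_of_mem_closure_two_seven (hA ▸ hp n)
  have hcoeff : ∀ n, m ≤ n → p.coeff n = 0 := by
    intro n hn
    by_contra hne
    have h2 : (2 : ℚ) ≤ p.coeff n := by
      have : 2 ≤ p.coeff n := by have := (hk n).1; omega
      exact_mod_cast this
    have hle : (p.coeff n : ℚ) * (9 / 2) ^ n ≤ Polynomial.aeval (9 / 2 : ℚ) p := by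
      rw [Polynomial.aeval_eq_sum_range]
      simp only [nsmul_eq_mul]
      exact Finset.single_le_sum (f := fun i => (p.coeff i : ℚ) * (9 / 2) ^ i)
        (fun _ _ => by positivity)
        (Finset.mem_range_succ_iff.2 (Polynomial.le_natDegree_of_ne_zero hne))
    have hpow : ((9 : ℚ) / 2) ^ m ≤ (9 / 2) ^ n := pow_le_pow_right₀ (by norm_num) hn
    have : 2 * ((9 : ℚ) / 2) ^ m ≤ p.coeff n * (9 / 2) ^ n := by gcongr
    linarith
  have hsum : Polynomial.aeval (9 / 2 : ℚ) p =
      ∑ n ∈ Finset.range m, (p.coeff n : ℚ) * (9 / 2) ^ n := by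
    rw [Polynomial.aeval_eq_sum_range' (n := max m (p.natDegree + 1)) (by omega)]
    simp only [nsmul_eq_mul]
    refine (Finset.sum_subset (Finset.range_mono (le_max_left _ _)) fun n _ hn => ?_).symm
    rw [hcoeff n (by simpa using hn), Nat.cast_zero, zero_mul]
  refine sum_mul_pow_nine_halves_ne hk m ?_
  rw [← hsum, hpx]
  ring
end
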